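/- arXiv:2505.18716 — 5 statements merged into one kernel-verified Lean document; each statement's English description precedes it below -/
import Mathlib

section
/- Let U ⊆ ℝ² be open, x: U → ℝ⁴ smooth and ξ, δ: U → ℝ⁴ \ {0} smooth, and let F(u,t,l) = x(u) + t ξ(u) + l δ(u). A point (u,t,l) ∈ U × ℝ × ℝ is a singular point of F (i.e. the derivative dF(u,t,l): ℝ⁴ → ℝ⁴ is not invertible) if and only if, with all partial derivatives evaluated at u, t²⟨ξ_{u1} ∧ ξ_{u2} ∧ ξ, δ⟩ + l²⟨δ_{u1} ∧ δ_{u2} ∧ ξ, δ⟩ + t l (⟨ξ_{u1} ∧ δ_{u2} ∧ ξ, δ⟩ + ⟨δ_{u1} ∧ ξ_{u2} ∧ ξ, δ⟩) + t (⟨ξ_{u1} ∧ x_{u2} ∧ ξ, δ⟩ + ⟨x_{u1} ∧ ξ_{u2} ∧ ξ, δ⟩) + l (⟨δ_{u1} ∧ x_{u2} ∧ ξ, δ⟩ + ⟨x_{u1} ∧ δ_{u2} ∧ ξ, δ⟩) + ⟨x_{u1} ∧ x_{u2} ∧ ξ, δ⟩ = 0. -/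
open Matrix

/-- The determinant of the 4×4 matrix whose columns are `a, b, c, d`;
this is the quantity `⟨a ∧ b ∧ c, d⟩`. -/
noncomputable def det4 (a b c d : Fin 4 → ℝ) : ℝ :=
  (Matrix.of fun i j => ![a, b, c, d] j i).det

/-- The partial derivative of `f` in the `i`-th coordinate direction at `u`. -/
noncomputable def pder {E : Type*} [NormedAddCommGroup E] [NormedSpace ℝ E]
    (f : (Fin 2 → ℝ) → E) (i : Fin 2) (u : Fin 2 → ℝ) : E :=
  fderiv ℝ f u (Pi.single i 1)

/-- The coordinates on `ℝ² × ℝ × ℝ`, as an equivalence with `ℝ⁴`. -/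
def coordEquiv : ((Fin 2 → ℝ) × ℝ × ℝ) ≃ (Fin 4 → ℝ) where
  toFun q := ![q.1 0, q.1 1, q.2.1, q.2.2]
  invFun w := (![w 0, w 1], w 2, w 3)
  left_inv q := by
    refine Prod.ext ?_ rfl
    ext i
    fin_cases i <;> rfl
  right_inv w := by
    ext i
    fin_cases i <;> rfl

theorem mulVec_bijective_iff_det_ne_zero {n : Type*} [Fintype n] [DecidableEq n]
    {K : Type*} [Field K] (A : Matrix n n K) :
    Function.Bijective A.mulVec ↔ A.det ≠ 0 := by
  rw [Function.Bijective, Matrix.mulVec_injective_iff_isUnit,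
    Matrix.mulVec_surjective_iff_isUnit, and_self, Matrix.isUnit_iff_isUnit_det, isUnit_iff_ne_zero]

/-- A linear map `ℝ² × ℝ × ℝ → ℝ⁴` is bijective iff the determinant of the images of the
coordinate vectors does not vanish. -/
theorem bijective_iff_det4_ne_zero (L : ((Fin 2 → ℝ) × ℝ × ℝ) →ₗ[ℝ] (Fin 4 → ℝ)) :
    Function.Bijective L ↔
      det4 (L (Pi.single 0 1, 0, 0)) (L (Pi.single 1 1, 0, 0)) (L (0, 1, 0)) (L (0, 0, 1)) ≠ 0 := by
  rw [det4, ← mulVec_bijective_iff_det_ne_zero, ← coordEquiv.bijective.of_comp_iff]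
  congr! 1
  ext q i
  have hq : q = q.1 0 • ((Pi.single 0 1, 0, 0) : (Fin 2 → ℝ) × ℝ × ℝ)
      + q.1 1 • ((Pi.single 1 1, 0, 0) : (Fin 2 → ℝ) × ℝ × ℝ)
      + q.2.1 • ((0, 1, 0) : (Fin 2 → ℝ) × ℝ × ℝ)
      + q.2.2 • ((0, 0, 1) : (Fin 2 → ℝ) × ℝ × ℝ) := by
    refine Prod.ext ?_ (by simp)
    ext j
    fin_cases j <;> simp
  conv_lhs => rw [hq]
  simp only [map_add, map_smul]
  simp [coordEquiv, Matrix.mulVec, dotProduct, Fin.sum_univ_four, mul_comm]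

theorem det4_eq (a b c d : Fin 4 → ℝ) :
    det4 a b c d =
      (a 0 * b 1 - a 1 * b 0) * (c 2 * d 3 - c 3 * d 2)
      - (a 0 * b 2 - a 2 * b 0) * (c 1 * d 3 - c 3 * d 1)
      + (a 0 * b 3 - a 3 * b 0) * (c 1 * d 2 - c 2 * d 1)
      + (a 1 * b 2 - a 2 * b 1) * (c 0 * d 3 - c 3 * d 0)
      - (a 1 * b 3 - a 3 * b 1) * (c 0 * d 2 - c 2 * d 0)
      + (a 2 * b 3 - a 3 * b 2) * (c 0 * d 1 - c 1 * d 0) := by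
  simp [det4, Matrix.det_succ_row_zero, Fin.sum_univ_succ, Fin.succAbove]
  ring

theorem fderiv_planeCongruence_apply {E G : Type*} [NormedAddCommGroup E] [NormedSpace ℝ E]
    [NormedAddCommGroup G] [NormedSpace ℝ G] {x ξ δ : E → G} {u : E}
    (hx : DifferentiableAt ℝ x u) (hξ : DifferentiableAt ℝ ξ u) (hδ : DifferentiableAt ℝ δ u)
    (t l : ℝ) (q : E × ℝ × ℝ) :
    fderiv ℝ (fun q : E × ℝ × ℝ => x q.1 + q.2.1 • ξ q.1 + q.2.2 • δ q.1) (u, t, l) q =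
      fderiv ℝ x u q.1 + (t • fderiv ℝ ξ u q.1 + q.2.1 • ξ u)
        + (l • fderiv ℝ δ u q.1 + q.2.2 • δ u) := by
  have h1 : HasFDerivAt (fun q : E × ℝ × ℝ => q.1) (ContinuousLinearMap.fst ℝ E (ℝ × ℝ))
      (u, t, l) := hasFDerivAt_fst
  have h2 : HasFDerivAt (fun q : E × ℝ × ℝ => q.2) (ContinuousLinearMap.snd ℝ E (ℝ × ℝ))
      (u, t, l) := hasFDerivAt_snd
  have hx' := HasFDerivAt.comp (u, t, l) (f := fun q : E × ℝ × ℝ => q.1) hx.hasFDerivAt h1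
  have hξ' := HasFDerivAt.comp (u, t, l) (f := fun q : E × ℝ × ℝ => q.1) hξ.hasFDerivAt h1
  have hδ' := HasFDerivAt.comp (u, t, l) (f := fun q : E × ℝ × ℝ => q.1) hδ.hasFDerivAt h1
  have h := (hx'.add (h2.fst.smul hξ')).add (h2.snd.smul hδ')
  exact (congrArg (fun L : (E × ℝ × ℝ) →L[ℝ] G => L q) h.fderiv :)

/-- A point `(u,t,l)` is a singular point of the 2-parameter plane congruence
`F(u,t,l) = x(u) + t ξ(u) + l δ(u)` (i.e. `dF(u,t,l)` is not invertible) if and only if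
the quadratic expression in `(t,l)` built from the determinants `⟨· ∧ · ∧ ξ, δ⟩` vanishes. -/
theorem stmt0 (U : Set (Fin 2 → ℝ)) (hU : IsOpen U)
    (x ξ δ : (Fin 2 → ℝ) → (Fin 4 → ℝ))
    (hx : ContDiffOn ℝ (⊤ : ℕ∞) x U) (hξ : ContDiffOn ℝ (⊤ : ℕ∞) ξ U)
    (hδ : ContDiffOn ℝ (⊤ : ℕ∞) δ U)
    (hξ0 : ∀ u ∈ U, ξ u ≠ 0) (hδ0 : ∀ u ∈ U, δ u ≠ 0)
    (F : ((Fin 2 → ℝ) × ℝ × ℝ) → (Fin 4 → ℝ))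
    (hF : F = fun q => x q.1 + q.2.1 • ξ q.1 + q.2.2 • δ q.1)
    (u : Fin 2 → ℝ) (hu : u ∈ U) (t l : ℝ) :
    ¬ Function.Bijective ⇑(fderiv ℝ F (u, t, l)) ↔
      t ^ 2 * det4 (pder ξ 0 u) (pder ξ 1 u) (ξ u) (δ u)
        + l ^ 2 * det4 (pder δ 0 u) (pder δ 1 u) (ξ u) (δ u)
        + t * l * (det4 (pder ξ 0 u) (pder δ 1 u) (ξ u) (δ u)
            + det4 (pder δ 0 u) (pder ξ 1 u) (ξ u) (δ u))
        + t * (det4 (pder ξ 0 u) (pder x 1 u) (ξ u) (δ u)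
            + det4 (pder x 0 u) (pder ξ 1 u) (ξ u) (δ u))
        + l * (det4 (pder δ 0 u) (pder x 1 u) (ξ u) (δ u)
            + det4 (pder x 0 u) (pder δ 1 u) (ξ u) (δ u))
        + det4 (pder x 0 u) (pder x 1 u) (ξ u) (δ u) = 0 := by
  have hnhds := hU.mem_nhds hu
  have hxu := (hx.contDiffAt hnhds).differentiableAt (by simp)
  have hξu := (hξ.contDiffAt hnhds).differentiableAt (by simp)
  have hδu := (hδ.contDiffAt hnhds).differentiableAt (by simp)
  have hbij := bijective_iff_det4_ne_zero (fderiv ℝ F (u, t, l)).toLinearMap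
  simp only [ContinuousLinearMap.coe_coe] at hbij
  rw [hbij, not_not, hF]
  simp only [fderiv_planeCongruence_apply hxu hξu hδu, map_zero, smul_zero, zero_smul, one_smul,
    add_zero, zero_add, ← pder.eq_1]
  simp only [det4_eq, Pi.add_apply, Pi.smul_apply, smul_eq_mul]
  constructor <;> intro h <;> linear_combination h
end

section
/- Let U ⊆ ℝ² be open, let x, W: U → ℝ⁴ be smooth, and define Δ: U × ℝ⁴ → ℝ by Δ(u,p) = ⟨W(u), x(u) − p⟩. If dW(u0): ℝ² → ℝ⁴ is injective, then for every p0 ∈ ℝ⁴ the map λ_Δ: U × ℝ⁴ → ℝ², λ_Δ(u,p) = (∂Δ/∂u1(u,p), ∂Δ/∂u2(u,p)), is a submersion at (u0, p0), i.e. its derivative d(λ_Δ)(u0,p0): ℝ⁶ → ℝ² is surjective. -/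
open Matrix

theorem Matrix.mulVec_surjective_of_vecMul_injective {m n : Type*} [Fintype m] [Fintype n]
    (M : Matrix m n ℝ) (h : Function.Injective fun c => c ᵥ* M) :
    Function.Surjective M.mulVec := by
  classical
  have hinj : Function.Injective (M * Mᵀ).mulVecLin := by
    rw [← LinearMap.ker_eq_bot, LinearMap.ker_eq_bot']
    intro c hc
    rw [Matrix.mulVecLin_apply, ← Matrix.mulVec_mulVec, Matrix.mulVec_transpose] at hc
    have h0 : (c ᵥ* M) ⬝ᵥ (c ᵥ* M) = 0 := by
      rw [← Matrix.dotProduct_mulVec, hc, dotProduct_zero]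
    exact h ((dotProduct_self_eq_zero.mp h0).trans (Matrix.zero_vecMul M).symm)
  intro y
  obtain ⟨c, hc⟩ := LinearMap.injective_iff_surjective.mp hinj y
  refine ⟨Mᵀ *ᵥ c, ?_⟩
  rw [Matrix.mulVec_mulVec]
  exact hc

theorem fderiv_dotProduct_sub_const {E ι : Type*} [NormedAddCommGroup E] [NormedSpace ℝ E]
    [Fintype ι] {W x : E → ι → ℝ} {u : E} (hW : DifferentiableAt ℝ W u)
    (hx : DifferentiableAt ℝ x u) (p : ι → ℝ) (e : E) :
    fderiv ℝ (fun v => W v ⬝ᵥ (x v - p)) u e =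
      fderiv ℝ W u e ⬝ᵥ (x u - p) + W u ⬝ᵥ fderiv ℝ x u e := by
  have h : HasFDerivAt (fun v => ∑ j, W v j * (x v j - p j)) _ u :=
    HasFDerivAt.fun_sum fun j _ =>
      (hasFDerivAt_pi'.mp hW.hasFDerivAt j).mul
        ((hasFDerivAt_pi'.mp hx.hasFDerivAt j).sub_const (p j))
  have h' : HasFDerivAt (fun v => W v ⬝ᵥ (x v - p)) _ u := h
  rw [h'.fderiv]
  simp [dotProduct, Finset.sum_add_distrib, mul_comm, add_comm]

/-- If the conormal map `W` is an immersion at `u0`, then the catastrophe map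
`λ_Δ(u,p) = (∂Δ/∂u1(u,p), ∂Δ/∂u2(u,p))` of the family of affine distance functions
`Δ(u,p) = ⟨W(u), x(u) − p⟩` is a submersion at `(u0, p0)` for every `p0`. -/
theorem stmt4 (U : Set (Fin 2 → ℝ)) (hU : IsOpen U)
    (x W : (Fin 2 → ℝ) → (Fin 4 → ℝ))
    (hx : ContDiffOn ℝ (⊤ : ℕ∞) x U) (hW : ContDiffOn ℝ (⊤ : ℕ∞) W U)
    (u0 : Fin 2 → ℝ) (hu0 : u0 ∈ U)
    (himm : Function.Injective ⇑(fderiv ℝ W u0))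
    (Δ : (Fin 2 → ℝ) × (Fin 4 → ℝ) → ℝ)
    (hΔ : Δ = fun q => W q.1 ⬝ᵥ (x q.1 - q.2))
    (lamΔ : (Fin 2 → ℝ) × (Fin 4 → ℝ) → (Fin 2 → ℝ))
    (hlam : lamΔ = fun q => fun i : Fin 2 =>
      fderiv ℝ (fun v => Δ (v, q.2)) q.1 (Pi.single i 1)) :
    ∀ p0 : Fin 4 → ℝ, Function.Surjective ⇑(fderiv ℝ lamΔ (u0, p0)) := by
  intro p0
  have hdiff : ∀ {f : (Fin 2 → ℝ) → (Fin 4 → ℝ)}, ContDiffOn ℝ (⊤ : ℕ∞) f U →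
      ∀ u ∈ U, DifferentiableAt ℝ f u := fun hf u hu =>
    (hf.contDiffAt (hU.mem_nhds hu)).differentiableAt (by simp)
  have hdiff' : ∀ {f : (Fin 2 → ℝ) → (Fin 4 → ℝ)}, ContDiffOn ℝ (⊤ : ℕ∞) f U →
      DifferentiableAt ℝ (fderiv ℝ f) u0 := fun hf =>
    ((hf.contDiffAt (hU.mem_nhds hu0)).fderiv_right (m := (⊤ : ℕ∞))
      le_rfl).differentiableAt (by simp)
  have hformula : ∀ u ∈ U, ∀ p, lamΔ (u, p) = fun i => fderiv ℝ W u (Pi.single i 1) ⬝ᵥ (x u - p) +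
      W u ⬝ᵥ fderiv ℝ x u (Pi.single i 1) := by
    intro u hu p
    subst hlam hΔ
    ext i
    exact fderiv_dotProduct_sub_const (hdiff hW u hu) (hdiff hx u hu) p _
  have hlamdiff : DifferentiableAt ℝ lamΔ (u0, p0) := by
    have hev : lamΔ =ᶠ[nhds (u0, p0)] fun q i =>
        ∑ j, fderiv ℝ W q.1 (Pi.single i 1) j * (x q.1 j - q.2 j) +
        ∑ j, W q.1 j * fderiv ℝ x q.1 (Pi.single i 1) j := by
      filter_upwards [continuous_fst.continuousAt.preimage_mem_nhds (hU.mem_nhds hu0)] with q hq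
      exact hformula q.1 hq q.2
    refine DifferentiableAt.congr_of_eventuallyEq ?_ hev
    have comp : ∀ {F : Type} [NormedAddCommGroup F] [NormedSpace ℝ F] {f : (Fin 2 → ℝ) → F},
        DifferentiableAt ℝ f u0 →
        DifferentiableAt ℝ (fun q : (Fin 2 → ℝ) × (Fin 4 → ℝ) => f q.1) (u0, p0) :=
      fun hf => DifferentiableAt.comp (u0, p0) (g := _) hf differentiableAt_fst
    have h1 := comp (hdiff hW u0 hu0)
    have h2 := comp (hdiff hx u0 hu0)
    have h3 := comp (hdiff' hW)
    have h4 := comp (hdiff' hx)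
    have h5 : ∀ i : Fin 2, DifferentiableAt ℝ (fun q : (Fin 2 → ℝ) × (Fin 4 → ℝ) =>
      fderiv ℝ W q.1 (Pi.single i 1)) (u0, p0) := fun i => h3.clm_apply (by fun_prop)
    have h6 : ∀ i : Fin 2, DifferentiableAt ℝ (fun q : (Fin 2 → ℝ) × (Fin 4 → ℝ) =>
      fderiv ℝ x q.1 (Pi.single i 1)) (u0, p0) := fun i => h4.clm_apply (by fun_prop)
    rw [differentiableAt_pi]
    intro i
    refine DifferentiableAt.add (DifferentiableAt.fun_sum fun j _ => ?_)
      (DifferentiableAt.fun_sum fun j _ => ?_)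
    · exact (differentiableAt_pi.mp (h5 i) j).mul
        ((differentiableAt_pi.mp h2 j).sub (by fun_prop))
    · exact (differentiableAt_pi.mp h1 j).mul (differentiableAt_pi.mp (h6 i) j)
  let M : Matrix (Fin 2) (Fin 4) ℝ := Matrix.of fun i => fderiv ℝ W u0 (Pi.single i 1)
  have hM : Function.Surjective M.mulVec := by
    refine M.mulVec_surjective_of_vecMul_injective ?_
    convert himm using 1
    ext c j
    conv_rhs => rw [pi_eq_sum_univ' c]
    simp [M, Matrix.vecMul, dotProduct]
  have hpartial : ∀ v, fderiv ℝ lamΔ (u0, p0) (0, v) = -(M *ᵥ v) := by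
    intro v
    have h1 : HasFDerivAt (fun p => lamΔ (u0, p)) _ p0 :=
      hlamdiff.hasFDerivAt.comp p0 (hasFDerivAt_prodMk_right u0 p0)
    have h2 : HasFDerivAt (fun p => lamΔ (u0, p))
        (-(LinearMap.toContinuousLinearMap M.mulVecLin)) p0 := by
      have := (LinearMap.toContinuousLinearMap M.mulVecLin).hasFDerivAt (x := p0)
      refine (this.const_sub (lamΔ (u0, 0))).congr_of_eventuallyEq (.of_forall fun p => ?_)
      ext i
      simp [hformula u0 hu0, M, Matrix.mulVec, dotProduct_sub]
      ring
    simpa using DFunLike.congr_fun (h1.unique h2) v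
  intro y
  obtain ⟨v, hv⟩ := hM (-y)
  exact ⟨(0, v), by rw [hpartial, hv, neg_neg]⟩
end

section
/- Let U ⊆ ℝ² be open and let x, W: U → ℝ⁴ be smooth maps with ⟨W(u), ∂x/∂u_j(u)⟩ = 0 for all u ∈ U and j = 1,2. Define Δ: U × ℝ⁴ → ℝ by Δ(u,p) = ⟨W(u), x(u) − p⟩. Let u0 ∈ U and suppose the 2×2 matrix with entries ⟨W(u0), ∂²x/∂u_i∂u_j(u0)⟩ is invertible. Then for every p0 ∈ ℝ⁴ the map λ_Δ(u,p) = (∂Δ/∂u1(u,p), ∂Δ/∂u2(u,p)) is a submersion at (u0,p0); i.e. the family of affine distance functions Δ is a Morse family of functions near (u0, p0). -/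
open Matrix

theorem DifferentiableAt.dotProduct_pi {E ι : Type*} [NormedAddCommGroup E] [NormedSpace ℝ E]
    [Fintype ι] {f g : E → ι → ℝ} {a : E}
    (hf : DifferentiableAt ℝ f a) (hg : DifferentiableAt ℝ g a) :
    DifferentiableAt ℝ (fun v => f v ⬝ᵥ g v) a := by
  rw [differentiableAt_pi] at hf hg
  exact DifferentiableAt.fun_sum fun k _ => (hf k).mul (hg k)

theorem fderiv_dotProduct_apply {E ι : Type*} [NormedAddCommGroup E] [NormedSpace ℝ E]
    [Fintype ι] {f g : E → ι → ℝ} {a : E}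
    (hf : DifferentiableAt ℝ f a) (hg : DifferentiableAt ℝ g a) (w : E) :
    fderiv ℝ (fun v => f v ⬝ᵥ g v) a w
      = f a ⬝ᵥ fderiv ℝ g a w + fderiv ℝ f a w ⬝ᵥ g a := by
  have hf' := hasFDerivAt_pi'.1 hf.hasFDerivAt
  have hg' := hasFDerivAt_pi'.1 hg.hasFDerivAt
  have h := HasFDerivAt.fun_sum fun k (_ : k ∈ Finset.univ) => (hf' k).fun_mul (hg' k)
  simp only [dotProduct, h.fderiv, ← Finset.sum_add_distrib]
  simp [mul_comm]

theorem ContDiffOn.differentiableAt_pder {E : Type*} [NormedAddCommGroup E] [NormedSpace ℝ E]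
    {f : (Fin 2 → ℝ) → E} {U : Set (Fin 2 → ℝ)} (hU : IsOpen U)
    (hf : ContDiffOn ℝ (⊤ : ℕ∞) f U) (i : Fin 2) {u : Fin 2 → ℝ} (hu : u ∈ U) :
    DifferentiableAt ℝ (pder f i) u := by
  have h : ContDiffAt ℝ 1 (fderiv ℝ f) u :=
    (hf.contDiffAt (hU.mem_nhds hu)).fderiv_right (by norm_cast)
  exact (h.differentiableAt one_ne_zero).clm_apply (differentiableAt_const _)

/-- If `W` annihilates the tangent plane of `x` at each point of `U` and the matrix
`(⟨W(u0), ∂²x/∂u_i∂u_j(u0)⟩)` is invertible, then the catastrophe map `λ_Δ` of the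
family of affine distance functions `Δ(u,p) = ⟨W(u), x(u) − p⟩` is a submersion at
`(u0, p0)` for every `p0`; i.e. `Δ` is a Morse family of functions near `(u0, p0)`. -/
theorem stmt5 (U : Set (Fin 2 → ℝ)) (hU : IsOpen U)
    (x W : (Fin 2 → ℝ) → (Fin 4 → ℝ))
    (hx : ContDiffOn ℝ (⊤ : ℕ∞) x U) (hW : ContDiffOn ℝ (⊤ : ℕ∞) W U)
    (horth : ∀ u ∈ U, ∀ j : Fin 2, W u ⬝ᵥ pder x j u = 0)
    (u0 : Fin 2 → ℝ) (hu0 : u0 ∈ U)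
    (hinv : IsUnit (Matrix.of fun i j : Fin 2 => W u0 ⬝ᵥ pder (pder x j) i u0))
    (Δ : (Fin 2 → ℝ) × (Fin 4 → ℝ) → ℝ)
    (hΔ : Δ = fun q => W q.1 ⬝ᵥ (x q.1 - q.2))
    (lamΔ : (Fin 2 → ℝ) × (Fin 4 → ℝ) → (Fin 2 → ℝ))
    (hlam : lamΔ = fun q => fun i : Fin 2 =>
      fderiv ℝ (fun v => Δ (v, q.2)) q.1 (Pi.single i 1)) :
    ∀ p0 : Fin 4 → ℝ, Function.Surjective ⇑(fderiv ℝ lamΔ (u0, p0)) := by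
  intro p0
  have hxd : ∀ u ∈ U, DifferentiableAt ℝ x u := fun u hu =>
    (hx.contDiffAt (hU.mem_nhds hu)).differentiableAt (by simp)
  have hWd : ∀ u ∈ U, DifferentiableAt ℝ W u := fun u hu =>
    (hW.contDiffAt (hU.mem_nhds hu)).differentiableAt (by simp)
  have hlocal : ∀ q : (Fin 2 → ℝ) × (Fin 4 → ℝ), q.1 ∈ U →
      lamΔ q = fun i => pder W i q.1 ⬝ᵥ (x q.1 - q.2) := by
    intro q hq
    subst hΔ hlam
    funext i
    have h0 := horth q.1 hq i
    rw [pder] at h0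
    simp only
    rw [fderiv_dotProduct_apply (hWd _ hq) ((hxd _ hq).sub_const _), fderiv_sub_const, h0,
      zero_add, pder]
  have hev : lamΔ =ᶠ[nhds (u0, p0)] fun q i => pder W i q.1 ⬝ᵥ (x q.1 - q.2) := by
    filter_upwards [(hU.preimage continuous_fst).mem_nhds (show (u0, p0).1 ∈ U from hu0)]
      with q hq using hlocal q hq
  have hdW : ∀ i, DifferentiableAt ℝ
      (fun q : (Fin 2 → ℝ) × (Fin 4 → ℝ) => pder W i q.1) (u0, p0) := fun i =>
    DifferentiableAt.comp (g := pder W i) (f := Prod.fst) (u0, p0)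
      (hW.differentiableAt_pder hU i hu0) differentiableAt_fst
  have hdx : DifferentiableAt ℝ
      (fun q : (Fin 2 → ℝ) × (Fin 4 → ℝ) => x q.1) (u0, p0) :=
    DifferentiableAt.comp (g := x) (f := Prod.fst) (u0, p0) (hxd u0 hu0) differentiableAt_fst
  have hdiff : DifferentiableAt ℝ lamΔ (u0, p0) := by
    refine hev.differentiableAt_iff.2 (differentiableAt_pi.2 fun i => ?_)
    exact (hdW i).dotProduct_pi (hdx.sub differentiableAt_snd)
  have hfib : ∀ e : Fin 4 → ℝ,
      fderiv ℝ lamΔ (u0, p0) (0, e) = fun i => -(pder W i u0 ⬝ᵥ e) := by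
    intro e
    have h1 : HasFDerivAt (fun p => lamΔ (u0, p))
        ((fderiv ℝ lamΔ (u0, p0)).comp (ContinuousLinearMap.inr ℝ _ _)) p0 :=
      hdiff.hasFDerivAt.comp p0 (hasFDerivAt_prodMk_right u0 p0)
    have h2 : (fun p => lamΔ (u0, p)) = fun p i => pder W i u0 ⬝ᵥ (x u0 - p) :=
      funext fun p => hlocal (u0, p) hu0
    rw [h2] at h1
    funext i
    have h3 := (hasFDerivAt_pi'.1 h1 i).fderiv
    have h4 := DFunLike.congr_fun h3 e
    rw [fderiv_dotProduct_apply (differentiableAt_const _) (by fun_prop), fderiv_const_sub] at h4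
    simpa using h4.symm
  have hsecond : ∀ i j, W u0 ⬝ᵥ pder (pder x j) i u0 = -(pder W i u0 ⬝ᵥ pder x j u0) := by
    intro i j
    have hz : (fun u => W u ⬝ᵥ pder x j u) =ᶠ[nhds u0] fun _ => 0 := by
      filter_upwards [hU.mem_nhds hu0] with u hu using horth u hu j
    have h := fderiv_dotProduct_apply (hWd u0 hu0) (hx.differentiableAt_pder hU j hu0)
      (Pi.single i 1)
    rw [hz.fderiv_eq] at h
    simp only [fderiv_fun_const, Pi.zero_apply, _root_.zero_apply] at h
    exact eq_neg_of_add_eq_zero_left h.symm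
  intro y
  obtain ⟨c, rfl⟩ := Matrix.mulVec_surjective_iff_isUnit.2 hinv y
  refine ⟨(0, ∑ j, c j • pder x j u0), ?_⟩
  rw [hfib]
  funext i
  simp [Matrix.mulVec, hsecond, dotProduct_add, mul_comm, add_comm]
end

section
/- Assume the decomposition hypotheses for the frame (ξ1, ξ2) along x, including the frame condition that ∂ξ_k/∂u_i has no ξ2-component. Given p ∈ ℝ⁴, let Z: U → ℝ², δ: U → ℝ, s: U → ℝ be the unique smooth maps with x(u) − p = dx(u)(Z(u)) + δ(u) ξ1(u) + s(u) ξ2(u) for all u ∈ U. Then for all u ∈ U and i = 1,2: ∂s/∂u_i(u) = −h2(u)(e_i, Z(u)) = −Σ_j h2_{ij}(u) Z_j(u). -/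
open Matrix

/-- The derivative is the combination of the partial derivatives. -/
lemma fderiv_apply_eq_pder {E : Type*} [NormedAddCommGroup E] [NormedSpace ℝ E]
    (f : (Fin 2 → ℝ) → E) (u v : Fin 2 → ℝ) :
    fderiv ℝ f u v = v 0 • pder f 0 u + v 1 • pder f 1 u := by
  have hv : v = v 0 • Pi.single 0 1 + v 1 • Pi.single 1 1 := by
    ext k
    fin_cases k <;> simp
  conv_lhs => rw [hv]
  simp [pder]

/-- In a frame adapted to `f`, a vanishing combination has vanishing last coefficient. -/
lemma last_coeff_eq_zero {E : Type*} [NormedAddCommGroup E] [NormedSpace ℝ E]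
    {f : (Fin 2 → ℝ) → E} {u : Fin 2 → ℝ} {n₁ n₂ : E}
    (hind : LinearIndependent ℝ ![pder f 0 u, pder f 1 u, n₁, n₂])
    {v : Fin 2 → ℝ} {a b : ℝ} (h : fderiv ℝ f u v + a • n₁ + b • n₂ = 0) : b = 0 := by
  refine Fintype.linearIndependent_iff.1 hind ![v 0, v 1, a, b] ?_ 3
  rw [fderiv_apply_eq_pder] at h
  simpa [Fin.sum_univ_four] using h

/-- Under the decomposition hypotheses for the transversal frame `(ξ1, ξ2)` along `x`
(including the condition that `∂ξ_k/∂u_i` has no `ξ2`-component), if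
`x(u) − p = dx(u)(Z(u)) + δ(u) ξ1(u) + s(u) ξ2(u)`, then the affine distance function `s`
satisfies `∂s/∂u_i(u) = −Σ_j h2_{ij}(u) Z_j(u)` for all `u ∈ U`. -/
theorem stmt6 (U : Set (Fin 2 → ℝ)) (hU : IsOpen U)
    (x ξ1 ξ2 : (Fin 2 → ℝ) → (Fin 4 → ℝ))
    (hx : ContDiffOn ℝ (⊤ : ℕ∞) x U) (hξ1 : ContDiffOn ℝ (⊤ : ℕ∞) ξ1 U)
    (hξ2 : ContDiffOn ℝ (⊤ : ℕ∞) ξ2 U)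
    (hind : ∀ u ∈ U, LinearIndependent ℝ ![pder x 0 u, pder x 1 u, ξ1 u, ξ2 u])
    (Γ : (Fin 2 → ℝ) → Fin 2 → Fin 2 → (Fin 2 → ℝ))
    (h1 h2 : (Fin 2 → ℝ) → Fin 2 → Fin 2 → ℝ)
    (hΓ : ContDiffOn ℝ (⊤ : ℕ∞) Γ U)
    (hh1 : ContDiffOn ℝ (⊤ : ℕ∞) h1 U) (hh2 : ContDiffOn ℝ (⊤ : ℕ∞) h2 U)
    (hdec2 : ∀ u ∈ U, ∀ i j : Fin 2,
      pder (pder x j) i u =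
        fderiv ℝ x u (Γ u i j) + h1 u i j • ξ1 u + h2 u i j • ξ2 u)
    (S1 S2 : (Fin 2 → ℝ) → Fin 2 → Fin 2 → ℝ)
    (τ1 τ2 : (Fin 2 → ℝ) → (Fin 2 → ℝ))
    (hS1 : ContDiffOn ℝ (⊤ : ℕ∞) S1 U) (hS2 : ContDiffOn ℝ (⊤ : ℕ∞) S2 U)
    (hτ1 : ContDiffOn ℝ (⊤ : ℕ∞) τ1 U) (hτ2 : ContDiffOn ℝ (⊤ : ℕ∞) τ2 U)
    (hdecξ1 : ∀ u ∈ U, ∀ i : Fin 2,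
      pder ξ1 i u = -fderiv ℝ x u (Matrix.of (S1 u) *ᵥ Pi.single i 1)
        + (τ1 u ⬝ᵥ Pi.single i 1) • ξ1 u)
    (hdecξ2 : ∀ u ∈ U, ∀ i : Fin 2,
      pder ξ2 i u = -fderiv ℝ x u (Matrix.of (S2 u) *ᵥ Pi.single i 1)
        + (τ2 u ⬝ᵥ Pi.single i 1) • ξ1 u)
    (p : Fin 4 → ℝ)
    (Z : (Fin 2 → ℝ) → (Fin 2 → ℝ)) (δp s : (Fin 2 → ℝ) → ℝ)
    (hZ : ContDiffOn ℝ (⊤ : ℕ∞) Z U) (hδp : ContDiffOn ℝ (⊤ : ℕ∞) δp U)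
    (hs : ContDiffOn ℝ (⊤ : ℕ∞) s U)
    (hdist : ∀ u ∈ U, x u - p = fderiv ℝ x u (Z u) + δp u • ξ1 u + s u • ξ2 u) :
    ∀ u ∈ U, ∀ i : Fin 2,
      fderiv ℝ s u (Pi.single i 1) = -∑ j : Fin 2, h2 u i j * Z u j := by
  intro u hu i
  have hU' : U ∈ nhds u := hU.mem_nhds hu
  have diff {E : Type} [NormedAddCommGroup E] [NormedSpace ℝ E] {f : (Fin 2 → ℝ) → E}
      (hf : ContDiffOn ℝ (⊤ : ℕ∞) f U) : DifferentiableAt ℝ f u :=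
    (hf.contDiffAt hU').differentiableAt (by simp)
  have hpx (j : Fin 2) : DifferentiableAt ℝ (pder x j) u :=
    (((hx.contDiffAt hU').fderiv_right (m := 1) (WithTop.coe_le_coe.2 le_top)).differentiableAt
      one_ne_zero).clm_apply (differentiableAt_const _)
  have hZd (j : Fin 2) : DifferentiableAt ℝ (fun w => Z w j) u :=
    differentiableAt_pi.1 (diff hZ) j
  have hev : (fun w => x w - p) =ᶠ[nhds u] fun w =>
      Z w 0 • pder x 0 w + Z w 1 • pder x 1 w + δp w • ξ1 w + s w • ξ2 w := by
    filter_upwards [hU'] with w hw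
    rw [hdist w hw, fderiv_apply_eq_pder]
  have hR := (((((hZd 0).hasFDerivAt.smul (hpx 0).hasFDerivAt).add
    ((hZd 1).hasFDerivAt.smul (hpx 1).hasFDerivAt)).add
    ((diff hδp).hasFDerivAt.smul (diff hξ1).hasFDerivAt)).add
    ((diff hs).hasFDerivAt.smul (diff hξ2).hasFDerivAt))
  have hL := (diff hx).hasFDerivAt.sub_const p
  have key := DFunLike.congr_fun (hL.unique (hR.congr_of_eventuallyEq hev)) (Pi.single i 1)
  have e0 := hdec2 u hu i 0
  have e1 := hdec2 u hu i 1
  have e2 := hdecξ1 u hu i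
  have e3 := hdecξ2 u hu i
  rw [pder] at e0 e1 e2 e3
  simp only [_root_.add_apply, _root_.smul_apply,
    ContinuousLinearMap.smulRight_apply, e0, e1, e2, e3] at key
  have hzero : fderiv ℝ s u (Pi.single i 1) + (h2 u i 0 * Z u 0 + h2 u i 1 * Z u 1) = 0 := by
    refine last_coeff_eq_zero (hind u hu)
      (v := ![fderiv ℝ (fun w => Z w 0) u (Pi.single i 1),
          fderiv ℝ (fun w => Z w 1) u (Pi.single i 1)]
        + Z u 0 • Γ u i 0 + Z u 1 • Γ u i 1 - δp u • (Matrix.of (S1 u) *ᵥ Pi.single i 1)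
        - s u • (Matrix.of (S2 u) *ᵥ Pi.single i 1) - Pi.single i 1)
      (a := fderiv ℝ δp u (Pi.single i 1) + Z u 0 * h1 u i 0 + Z u 1 * h1 u i 1
        + δp u * (τ1 u ⬝ᵥ Pi.single i 1) + s u * (τ2 u ⬝ᵥ Pi.single i 1)) ?_
    simp only [map_add, map_sub, map_smul]
    rw [key, fderiv_apply_eq_pder x u ![_, _]]
    simp only [Matrix.cons_val_zero, Matrix.cons_val_one]
    module
  rw [Fin.sum_univ_two]
  linarith
end

section
/- Assume the decomposition hypotheses for the frame (ξ1, ξ2) along x, including the frame condition that ∂ξ_k/∂u_i has no ξ2-component. Given p ∈ ℝ⁴, let Z: U → ℝ², δ: U → ℝ, s: U → ℝ be the unique smooth maps with x(u) − p = dx(u)(Z(u)) + δ(u) ξ1(u) + s(u) ξ2(u) for all u ∈ U. Let u0 ∈ U and suppose ∂s/∂u1(u0) = ∂s/∂u2(u0) = 0 and that the matrix (h2_{ij}(u0)) is invertible. Then Z(u0) = 0; consequently x(u0) − p belongs to the plane spanned by ξ1(u0) and ξ2(u0). -/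
open Matrix

/-- Some functional is `1` on the last of four independent vectors and `0` on the others. -/
lemma exists_linearMap_eq_one_of_linearIndependent {a b c d : Fin 4 → ℝ}
    (h : LinearIndependent ℝ ![a, b, c, d]) :
    ∃ φ : (Fin 4 → ℝ) →ₗ[ℝ] ℝ, φ a = 0 ∧ φ b = 0 ∧ φ c = 0 ∧ φ d = 1 := by
  let B := basisOfLinearIndependentOfCardEqFinrank h (by simp)
  have hB (k : Fin 4) : B.coord 3 (![a, b, c, d] k) = if k = 3 then 1 else 0 := by
    have hk : B k = ![a, b, c, d] k :=
      congrFun (coe_basisOfLinearIndependentOfCardEqFinrank h (by simp)) k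
    rw [← hk, Module.Basis.coord_apply, Module.Basis.repr_self, Finsupp.single_apply]
  exact ⟨B.coord 3, by simpa using hB 0, by simpa using hB 1, by simpa using hB 2,
    by simpa using hB 3⟩

/-- A functional that kills both partial derivatives of `x` kills the range of its derivative. -/
lemma map_fderiv_eq_zero_of_map_pder_eq_zero {x : (Fin 2 → ℝ) → (Fin 4 → ℝ)} {u : Fin 2 → ℝ}
    {φ : (Fin 4 → ℝ) →ₗ[ℝ] ℝ} (h0 : φ (pder x 0 u) = 0) (h1 : φ (pder x 1 u) = 0)
    (v : Fin 2 → ℝ) : φ (fderiv ℝ x u v) = 0 := by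
  have hv : v = v 0 • Pi.single 0 1 + v 1 • Pi.single 1 1 := by
    ext k; fin_cases k <;> simp
  rw [hv]
  simp only [map_add, map_smul]
  unfold pder at h0 h1
  simp [h0, h1]

/-- Under the decomposition hypotheses for the transversal frame `(ξ1, ξ2)` along `x`
(including the condition that `∂ξ_k/∂u_i` has no `ξ2`-component), if `u0` is a critical
point of the affine distance function `s` of `p` and the matrix `(h2_{ij}(u0))` is
invertible, then `Z(u0) = 0`; consequently `x(u0) − p` lies in the plane spanned by
`ξ1(u0)` and `ξ2(u0)`. -/
theorem stmt7 (U : Set (Fin 2 → ℝ)) (hU : IsOpen U)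
    (x ξ1 ξ2 : (Fin 2 → ℝ) → (Fin 4 → ℝ))
    (hx : ContDiffOn ℝ (⊤ : ℕ∞) x U) (hξ1 : ContDiffOn ℝ (⊤ : ℕ∞) ξ1 U)
    (hξ2 : ContDiffOn ℝ (⊤ : ℕ∞) ξ2 U)
    (hind : ∀ u ∈ U, LinearIndependent ℝ ![pder x 0 u, pder x 1 u, ξ1 u, ξ2 u])
    (Γ : (Fin 2 → ℝ) → Fin 2 → Fin 2 → (Fin 2 → ℝ))
    (h1 h2 : (Fin 2 → ℝ) → Fin 2 → Fin 2 → ℝ)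
    (hΓ : ContDiffOn ℝ (⊤ : ℕ∞) Γ U)
    (hh1 : ContDiffOn ℝ (⊤ : ℕ∞) h1 U) (hh2 : ContDiffOn ℝ (⊤ : ℕ∞) h2 U)
    (hdec2 : ∀ u ∈ U, ∀ i j : Fin 2,
      pder (pder x j) i u =
        fderiv ℝ x u (Γ u i j) + h1 u i j • ξ1 u + h2 u i j • ξ2 u)
    (S1 S2 : (Fin 2 → ℝ) → Fin 2 → Fin 2 → ℝ)
    (τ1 τ2 : (Fin 2 → ℝ) → (Fin 2 → ℝ))
    (hS1 : ContDiffOn ℝ (⊤ : ℕ∞) S1 U) (hS2 : ContDiffOn ℝ (⊤ : ℕ∞) S2 U)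
    (hτ1 : ContDiffOn ℝ (⊤ : ℕ∞) τ1 U) (hτ2 : ContDiffOn ℝ (⊤ : ℕ∞) τ2 U)
    (hdecξ1 : ∀ u ∈ U, ∀ i : Fin 2,
      pder ξ1 i u = -fderiv ℝ x u (Matrix.of (S1 u) *ᵥ Pi.single i 1)
        + (τ1 u ⬝ᵥ Pi.single i 1) • ξ1 u)
    (hdecξ2 : ∀ u ∈ U, ∀ i : Fin 2,
      pder ξ2 i u = -fderiv ℝ x u (Matrix.of (S2 u) *ᵥ Pi.single i 1)
        + (τ2 u ⬝ᵥ Pi.single i 1) • ξ1 u)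
    (p : Fin 4 → ℝ)
    (Z : (Fin 2 → ℝ) → (Fin 2 → ℝ)) (δp s : (Fin 2 → ℝ) → ℝ)
    (hZ : ContDiffOn ℝ (⊤ : ℕ∞) Z U) (hδp : ContDiffOn ℝ (⊤ : ℕ∞) δp U)
    (hs : ContDiffOn ℝ (⊤ : ℕ∞) s U)
    (hdist : ∀ u ∈ U, x u - p = fderiv ℝ x u (Z u) + δp u • ξ1 u + s u • ξ2 u)
    (u0 : Fin 2 → ℝ) (hu0 : u0 ∈ U)
    (hcrit : ∀ i : Fin 2, fderiv ℝ s u0 (Pi.single i 1) = 0)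
    (hinv : IsUnit (Matrix.of (h2 u0))) :
    Z u0 = 0 ∧ x u0 - p ∈ Submodule.span ℝ {ξ1 u0, ξ2 u0} := by
  have hUn := hU.mem_nhds hu0
  have hdx : DifferentiableAt ℝ x u0 := (hx.contDiffAt hUn).differentiableAt (by simp)
  have hdξ1 : DifferentiableAt ℝ ξ1 u0 := (hξ1.contDiffAt hUn).differentiableAt (by simp)
  have hdξ2 : DifferentiableAt ℝ ξ2 u0 := (hξ2.contDiffAt hUn).differentiableAt (by simp)
  have hdZ : DifferentiableAt ℝ Z u0 := (hZ.contDiffAt hUn).differentiableAt (by simp)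
  have hdδ : DifferentiableAt ℝ δp u0 := (hδp.contDiffAt hUn).differentiableAt (by simp)
  have hds : DifferentiableAt ℝ s u0 := (hs.contDiffAt hUn).differentiableAt (by simp)
  have hddx : DifferentiableAt ℝ (fderiv ℝ x) u0 :=
    ((hx.contDiffAt hUn).fderiv_right (m := 1) (by norm_cast)).differentiableAt (by simp)
  obtain ⟨φ, hφ0, hφ1, hφξ1, hφξ2⟩ := exists_linearMap_eq_one_of_linearIndependent (hind u0 hu0)
  have hφx := map_fderiv_eq_zero_of_map_pder_eq_zero hφ0 hφ1
  have hφξ1' (i : Fin 2) : φ (fderiv ℝ ξ1 u0 (Pi.single i 1)) = 0 := by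
    have := congrArg φ (hdecξ1 u0 hu0 i)
    simpa only [pder, map_add, map_neg, map_smul, hφx, hφξ1, smul_zero, neg_zero, add_zero]
      using this
  have hφξ2' (i : Fin 2) : φ (fderiv ℝ ξ2 u0 (Pi.single i 1)) = 0 := by
    have := congrArg φ (hdecξ2 u0 hu0 i)
    simpa only [pder, map_add, map_neg, map_smul, hφx, hφξ1, smul_zero, neg_zero, add_zero]
      using this
  have hφxx (i j : Fin 2) :
      φ (fderiv ℝ (fderiv ℝ x) u0 (Pi.single i 1) (Pi.single j 1)) = h2 u0 i j := by
    have hj : pder (pder x j) i u0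
        = fderiv ℝ (fderiv ℝ x) u0 (Pi.single i 1) (Pi.single j 1) := by
      have := (hddx.hasFDerivAt.clm_apply
        (hasFDerivAt_const (Pi.single j 1 : Fin 2 → ℝ) u0)).fderiv
      change fderiv ℝ (fun u => fderiv ℝ x u (Pi.single j 1)) u0 (Pi.single i 1) = _
      rw [this]
      simp
    rw [← hj, hdec2 u0 hu0 i j]
    simp [hφx, hφξ1, hφξ2]
  have hcoord (i : Fin 2) : h2 u0 i 0 * Z u0 0 + h2 u0 i 1 * Z u0 1 = 0 := by
    have hright := ((hddx.hasFDerivAt.clm_apply hdZ.hasFDerivAt).add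
      (hdδ.hasFDerivAt.smul hdξ1.hasFDerivAt)).add (hds.hasFDerivAt.smul hdξ2.hasFDerivAt)
    have hleft := (hdx.hasFDerivAt.sub_const p).congr_of_eventuallyEq
      (Filter.eventuallyEq_of_mem hUn fun u hu => (hdist u hu).symm)
    have h := congrArg φ (DFunLike.congr_fun (hright.unique hleft) (Pi.single i 1))
    have hv : Z u0 = Z u0 0 • Pi.single 0 1 + Z u0 1 • Pi.single 1 1 := by
      ext k; fin_cases k <;> simp
    have hZZ : φ (fderiv ℝ (fderiv ℝ x) u0 (Pi.single i 1) (Z u0)) = 0 := by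
      simpa [hφx, hφξ1, hφξ2, hφξ1', hφξ2', hcrit] using h
    rw [hv] at hZZ
    simp only [map_add, map_smul, hφxx, smul_eq_mul] at hZZ
    linarith
  have hZ0 : Z u0 = 0 := by
    apply Matrix.mulVec_injective_of_isUnit hinv
    ext i
    simpa [Matrix.mulVec, dotProduct, Fin.sum_univ_two] using hcoord i
  refine ⟨hZ0, ?_⟩
  rw [hdist u0 hu0, hZ0, map_zero, zero_add]
  exact Submodule.mem_span_pair.mpr ⟨_, _, rfl⟩
end
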